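/- arXiv:2108.09390 — 2 statements merged into one kernel-verified Lean document; each statement's English description precedes it below -/
import Mathlib

section
/- Let G and H be finitely generated groups with finite generating sets Σ_G and Σ_H and normal forms η_G and η_H respectively, such that the solution language of every finite system of equations in G with respect to η_G is EDT0L, and likewise for H with respect to η_H. Then: (1) the solution language of every finite system of equations in the direct product G × H, with respect to the normal form η over Σ_G ⊔ Σ_H defined by η(g, h) = η_G(g)η_H(h), is EDT0L; (2) if η_G and η_H are both regular then η is regular, and if η_G and η_H are both quasigeodesic then η is quasigeodesic. -/
namespace Paper

/-- Apply a letterwise substitution (i.e. the endomorphism of the free monoid `C*`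
determined by its action on letters) to a word over `C`. -/
def subApply {C : Type*} (f : C → List C) (w : List C) : List C := (w.map f).flatten

/-- An EDT0L system: a finite extended alphabet `C`, an identification of some letters of
`C` with terminal letters of the alphabet `α` (injectively, modelling `Σ ⊆ C`), a start
word over `C`, and a rational control: a regular language over a finite set of letterwise
substitutions (endomorphisms of `C*`), a word of endomorphisms acting by composition. -/
structure EDT0LSystem (α : Type*) where
  C : Type
  finC : Fintype C
  term : C → Option α
  term_inj : ∀ c c' a, term c = some a → term c' = some a → c = c'
  start : List C
  ι : Type
  finι : Fintype ι
  tab : ι → C → List C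
  control : Language ι
  control_reg : control.IsRegular

/-- The endomorphism of `C*` given by a word of basic endomorphisms, applied to `w`
(the word `φ₁φ₂⋯φₖ` acts as `φ₁∘φ₂∘⋯∘φₖ`, functions written on the right). -/
def EDT0LSystem.apply {α : Type*} (S : EDT0LSystem α) (φs : List S.ι) (w : List S.C) :
    List S.C :=
  φs.foldl (fun v i => subApply (S.tab i) v) w

/-- The language accepted by an EDT0L system: `{ωφ : φ ∈ R} ∩ Σ*`. -/
def EDT0LSystem.accepts {α : Type*} (S : EDT0LSystem α) : Language α :=
  { w | ∃ φs ∈ S.control, (S.apply φs S.start).map S.term = w.map Option.some }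

/-- A language is EDT0L if it is accepted by some EDT0L system. -/
def IsEDT0L {α : Type*} (L : Language α) : Prop := ∃ S : EDT0LSystem α, S.accepts = L

/-- Evaluate a word over the alphabet `Σ ∪ Σ⁻¹` (a letter is a generator index together
with a sign) in a group. -/
def evalWord {G : Type*} [Group G] {ι : Type*} (gen : ι → G) (w : List (ι × Bool)) : G :=
  (w.map fun l => if l.2 then gen l.1 else (gen l.1)⁻¹).prod

/-- The word length of `g` with respect to the generating set `gen`. -/
noncomputable def wordLength {G : Type*} [Group G] {ι : Type*} (gen : ι → G) (g : G) : ℕ :=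
  sInf {n | ∃ w : List (ι × Bool), evalWord gen w = g ∧ w.length = n}

/-- A normal form is quasigeodesic if `|η(g)| ≤ λ·|g| + λ` for some `λ > 0`. -/
def IsQuasigeodesicNF {G : Type*} [Group G] {ι : Type*} (gen : ι → G)
    (η : G → List (ι × Bool)) : Prop :=
  ∃ lam : ℝ, 0 < lam ∧ ∀ g : G, ((η g).length : ℝ) ≤ lam * (wordLength gen g) + lam

/-- A normal form is regular if its image is a regular language. -/
def IsRegularNF {G : Type*} [Group G] {ι : Type*} (η : G → List (ι × Bool)) : Prop :=
  Language.IsRegular (Set.range η : Language (ι × Bool))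

/-- A subset of a group is rational if it is the image of a regular language under the
evaluation map from the free monoid on a finite monoid generating set. -/
def IsRationalSubset {G : Type*} [Group G] (A : Set G) : Prop :=
  ∃ (ι : Type) (_ : Fintype ι) (gen : ι → G) (L : Language ι),
    Submonoid.closure (Set.range gen) = ⊤ ∧ L.IsRegular ∧
      A = (fun w : List ι => (w.map gen).prod) '' L

/-- A subset of a group is recognisable if its full preimage under the evaluation map
from the free monoid on a finite monoid generating set is a regular language. -/
def IsRecognisableSubset {G : Type*} [Group G] (A : Set G) : Prop :=
  ∃ (ι : Type) (_ : Fintype ι) (gen : ι → G),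
    Submonoid.closure (Set.range gen) = ⊤ ∧
      Language.IsRegular ({w : List ι | (w.map gen).prod ∈ A} : Language ι)

/-- The word `w₁ # w₂ # ⋯ # wₘ` over `β ⊕ {#}`. -/
def hashWord {β : Type*} {m : ℕ} (ws : Fin m → List β) : List (β ⊕ Unit) :=
  List.intercalate [Sum.inr ()] (List.ofFn fun i => (ws i).map Sum.inl)

/-- `g : Fin m → G` is a solution of the system `E ⊆ G ∗ F_X` of equations. -/
def SolvesSystem {G : Type*} [Group G] {m : ℕ}
    (E : Set (Monoid.Coprod G (FreeGroup (Fin m)))) (g : Fin m → G) : Prop :=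
  ∀ e ∈ E, Monoid.Coprod.lift (MonoidHom.id G) (FreeGroup.lift g) e = 1

/-- The solution language of a system of equations with constraints, w.r.t. a normal form. -/
def solutionLanguageC {G : Type*} [Group G] {ι : Type*} (η : G → List (ι × Bool)) {m : ℕ}
    (E : Set (Monoid.Coprod G (FreeGroup (Fin m)))) (Rc : Fin m → Set G) :
    Language ((ι × Bool) ⊕ Unit) :=
  { w | ∃ g : Fin m → G, SolvesSystem E g ∧ (∀ i, g i ∈ Rc i) ∧
      w = hashWord fun i => η (g i) }

/-- The solution language of a system of equations, w.r.t. a normal form. -/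
def solutionLanguage {G : Type*} [Group G] {ι : Type*} (η : G → List (ι × Bool)) {m : ℕ}
    (E : Set (Monoid.Coprod G (FreeGroup (Fin m)))) : Language ((ι × Bool) ⊕ Unit) :=
  solutionLanguageC η E fun _ => Set.univ

/-- Evaluate a twisted word (a word over `H ∪ (F_X × Ω)`) at the assignment `g` of the
variables: each letter `(u, ψ)` becomes `ψ(uφ)` where `φ` is the homomorphism `F_X → H`
determined by `g`, and the word is multiplied out in `H`. -/
def twistedEval {H : Type*} [Group H] {m : ℕ} (Ω : Subgroup (MulAut H)) (g : Fin m → H)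
    (w : List (H ⊕ (FreeGroup (Fin m) × Ω))) : H :=
  (w.map (Sum.elim id fun p => (p.2 : MulAut H) (FreeGroup.lift g p.1))).prod

/-- The solution language of a system of `Ω`-twisted equations with constraints. -/
def twistedSolutionLanguage {H : Type*} [Group H] {ι : Type*} (Ω : Subgroup (MulAut H))
    (η : H → List (ι × Bool)) {m : ℕ}
    (E : Set (List (H ⊕ (FreeGroup (Fin m) × Ω)))) (Rc : Fin m → Set H) :
    Language ((ι × Bool) ⊕ Unit) :=
  { w | ∃ g : Fin m → H, (∀ e ∈ E, twistedEval Ω g e = 1) ∧ (∀ i, g i ∈ Rc i) ∧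
      w = hashWord fun i => η (g i) }


/-- Apply a word of letterwise substitutions from left to right. -/
def applyAll {C ι : Type*} (tab : ι → C → List C) (φs : List ι) (v : List C) : List C :=
  φs.foldl (fun v i => subApply (tab i) v) v

section Substitutions

variable {C D ι : Type*}

@[simp] theorem subApply_nil (f : C → List C) : subApply f [] = [] := rfl

@[simp] theorem subApply_cons (f : C → List C) (c : C) (v : List C) :
    subApply f (c :: v) = f c ++ subApply f v := by
  simp [subApply]

@[simp] theorem subApply_append (f : C → List C) (u v : List C) :
    subApply f (u ++ v) = subApply f u ++ subApply f v := by
  simp [subApply]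

theorem subApply_intercalate (f : C → List C) (s : List C) (L : List (List C)) :
    subApply f (s.intercalate L) = (subApply f s).intercalate (L.map (subApply f)) := by
  induction L with
  | nil => simp
  | cons x L ih => cases L <;> simp_all

theorem map_intercalate' (f : C → D) (s : List C) (L : List (List C)) :
    (s.intercalate L).map f = (s.map f).intercalate (L.map (List.map f)) := by
  induction L with
  | nil => simp
  | cons x L ih => cases L <;> simp_all

theorem subApply_map (f : D → List D) (g : C → List C) (e : C → D)
    (h : ∀ c, f (e c) = (g c).map e) (v : List C) :
    subApply f (v.map e) = (subApply g v).map e := by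
  induction v with
  | nil => rfl
  | cons c v ih => simp [h, ih]

theorem subApply_map_eq_self (f : D → List D) (e : C → D) (h : ∀ c, f (e c) = [e c])
    (v : List C) : subApply f (v.map e) = v.map e := by
  induction v with
  | nil => rfl
  | cons c v ih => simp [h, ih]

@[simp] theorem applyAll_nil (tab : ι → C → List C) (v : List C) : applyAll tab [] v = v := rfl

@[simp] theorem applyAll_cons (tab : ι → C → List C) (i : ι) (φs : List ι) (v : List C) :
    applyAll tab (i :: φs) v = applyAll tab φs (subApply (tab i) v) := rfl

theorem applyAll_concat (tab : ι → C → List C) (i : ι) (φs : List ι) (v : List C) :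
    applyAll tab (φs ++ [i]) v = subApply (tab i) (applyAll tab φs v) := by
  simp [applyAll]

theorem applyAll_append (tab : ι → C → List C) (φs : List ι) (u v : List C) :
    applyAll tab φs (u ++ v) = applyAll tab φs u ++ applyAll tab φs v := by
  induction φs generalizing u v with
  | nil => rfl
  | cons i φs ih => simp [ih]

end Substitutions

section Somes

variable {α β γ : Type*}

theorem exists_eq_map_some {x : List (Option α)} (h : ∀ o ∈ x, o ≠ none) :
    ∃ t : List α, x = t.map some := by
  induction x with
  | nil => exact ⟨[], rfl⟩
  | cons o x ih =>
    obtain ⟨t, rfl⟩ := ih fun o ho => h o (List.mem_cons_of_mem _ ho)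
    obtain ⟨a, rfl⟩ := Option.ne_none_iff_exists'.1 (h o List.mem_cons_self)
    exact ⟨a :: t, rfl⟩

theorem map_some_injective : Function.Injective (List.map (some : α → Option α)) :=
  List.map_injective_iff.2 (Option.some_injective α)

theorem exists_eq_map_some_of_subset (f : α → β) {x : List (Option α)} {w : List β}
    (h : x.map (Option.map f) ⊆ w.map some) : ∃ t : List α, x = t.map some := by
  refine exists_eq_map_some fun o ho hn => ?_
  subst hn
  have := h (List.mem_map_of_mem ho)
  simp at this

end Somes

section HashWords

variable {β : Type*}

theorem mem_hash_intercalate {γ : Type*} (h : γ) {L : List (List γ)} {x : List γ} (hx : x ∈ L) :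
    x ⊆ List.intercalate [h] L := by
  induction L with
  | nil => simp at hx
  | cons y L ih =>
    cases L with
    | nil => simp_all
    | cons z L =>
      rw [List.intercalate_cons_cons]
      rcases List.mem_cons.1 hx with rfl | hx
      · intro a ha
        simp [ha]
      · intro a ha
        have := ih hx ha
        simp [this]

theorem map_some_hashWord {m : ℕ} (t : Fin m → List β) :
    (hashWord t).map some = List.intercalate [some (Sum.inr ())]
      (List.ofFn fun b => ((t b).map some).map (Option.map Sum.inl)) := by
  rw [hashWord, map_intercalate', List.map_ofFn]
  simp [Function.comp_def]

/-- The letters of `u` (over `β ⊕ {#}`) which are preceded by `k` letters `#`, modulo `M`. -/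
def hashBlock {M : ℕ} [NeZero M] : Fin M → List (β ⊕ Unit) → List β
  | _, [] => []
  | k, Sum.inl a :: u => if k = 0 then a :: hashBlock k u else hashBlock k u
  | k, Sum.inr _ :: u => hashBlock (k - 1) u

theorem hashBlock_map_inl {M : ℕ} [NeZero M] (k : Fin M) (w : List β) :
    hashBlock k (w.map Sum.inl) = if k = 0 then w else [] := by
  induction w with
  | nil => simp [hashBlock]
  | cons a w ih =>
    simp only [List.map_cons, hashBlock, ih]
    split_ifs <;> rfl

theorem hashBlock_map_inl_append {M : ℕ} [NeZero M] (k : Fin M) (w : List β)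
    (u : List (β ⊕ Unit)) :
    hashBlock k (w.map Sum.inl ++ Sum.inr () :: u) =
      (if k = 0 then w else []) ++ hashBlock (k - 1) u := by
  induction w with
  | nil => simp [hashBlock]
  | cons a w ih =>
    simp only [List.map_cons, List.cons_append, hashBlock, ih]
    split_ifs <;> rfl

theorem hashBlock_hashWord_eq_flatten {M m : ℕ} [NeZero M] (k : Fin M) (t : Fin m → List β) :
    hashBlock k (hashWord t) =
      (List.ofFn fun j : Fin m => if k = Fin.ofNat M j then t j else []).flatten := by
  induction m generalizing k with
  | zero => simp [hashWord, hashBlock]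
  | succ m ih =>
    cases m with
    | zero => simp [hashWord, hashBlock_map_inl]
    | succ m =>
      have hsplit : hashWord t = (t 0).map Sum.inl ++ Sum.inr () :: hashWord fun j => t j.succ := by
        simp [hashWord]
      rw [hsplit, hashBlock_map_inl_append, ih, List.ofFn_succ (n := m + 1), List.flatten_cons]
      congr 3
      funext j
      have hj : Fin.ofNat M j + 1 = Fin.ofNat M j.succ := by
        ext
        simp [Fin.val_add]
      simp only [sub_eq_iff_eq_add, hj]

theorem hashBlock_hashWord {M : ℕ} [NeZero M] (k : Fin M) (t : Fin M → List β) :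
    hashBlock k (hashWord t) = t k := by
  have key : ∀ (n : ℕ) (k : Fin n) (s : Fin n → List β),
      (List.ofFn fun j => if k = j then s j else []).flatten = s k := by
    intro n
    induction n with
    | zero => exact fun k => k.elim0
    | succ n ih =>
      intro k s
      rw [List.ofFn_succ, List.flatten_cons]
      cases k using Fin.cases with
      | zero =>
        rw [List.flatten_eq_nil_iff.2]
        · simp
        · simp [(Fin.succ_ne_zero _).symm]
      | succ k => simpa using ih k fun j => s j.succ
  rw [hashBlock_hashWord_eq_flatten]
  simpa using key M k t

end HashWords

/-- A set of `m`-tuples of words generated in parallel by a common deterministic controlled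
table system: `j` selects the tuple of start words, words of tables are read by a finite
automaton, and finally each letter is replaced by a word, where `none` means rejection. -/
def IsParallelEDT0L {β : Type} {m : ℕ} (T : Set (Fin m → List β)) : Prop :=
  ∃ (C J ι Q : Type) (_ : Finite C) (_ : Finite J) (_ : Finite ι) (_ : Finite Q)
    (tab : ι → C → List C) (out : C → List (Option β)) (start : J → Fin m → List C)
    (step : Q → ι → Q) (init : J → Q) (acc : Set Q),
    ∀ t, t ∈ T ↔ ∃ j φs, φs.foldl step (init j) ∈ acc ∧
      ∀ b, (applyAll tab φs (start j b)).flatMap out = (t b).map some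

section Segments

variable {C ι : Type*} {M : ℕ} [NeZero M]

/-- Label each letter of a word with `k` minus the total weight of the letters before it. -/
def labelWord (n : C → Fin M) : Fin M → List C → List (C × Fin M)
  | _, [] => []
  | k, c :: v => (c, k) :: labelWord n (k - n c) v

theorem labelWord_append (n : C → Fin M) (k : Fin M) (u v : List C) :
    labelWord n k (u ++ v) = labelWord n k u ++ labelWord n (k - (u.map n).sum) v := by
  induction u generalizing k with
  | nil => simp [labelWord]
  | cons c u ih => simp [labelWord, ih, sub_sub]

omit [NeZero M] in
theorem exists_mem_labelWord (n : C → Fin M) (k : Fin M) {v : List C} {c : C} (hc : c ∈ v) :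
    ∃ k', (c, k') ∈ labelWord n k v := by
  induction v generalizing k with
  | nil => simp at hc
  | cons d v ih =>
    rcases List.mem_cons.1 hc with rfl | hc
    · exact ⟨k, List.mem_cons_self⟩
    · obtain ⟨k', hk'⟩ := ih (k - n d) hc
      exact ⟨k', List.mem_cons_of_mem _ hk'⟩

/-- The weights pulled back along a substitution. -/
def pullWeight (f : C → List C) (n : C → Fin M) (c : C) : Fin M := ((f c).map n).sum

/-- The substitution on labelled letters induced by a substitution, given the weights of the
letters of its image. -/
def labelTab (tab : ι → C → List C) (i : ι × (C → Fin M)) (c : C × Fin M) : List (C × Fin M) :=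
  labelWord i.2 c.2 (tab i.1 c.1)

theorem subApply_labelWord (tab : ι → C → List C) (i : ι) (n : C → Fin M) (k : Fin M)
    (v : List C) :
    subApply (labelTab tab (i, n)) (labelWord (pullWeight (tab i) n) k v) =
      labelWord n k (subApply (tab i) v) := by
  induction v generalizing k with
  | nil => rfl
  | cons c v ih => simp [labelWord, labelTab, labelWord_append, ih, pullWeight]

open Classical in
/-- Check that the weights annotating the tables are consistent. -/
noncomputable def weightStep (tab : ι → C → List C) (n : Option (C → Fin M))
    (i : ι × (C → Fin M)) : Option (C → Fin M) :=
  if n = some (pullWeight (tab i.1) i.2) then some i.2 else none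

theorem foldl_weightStep_none (tab : ι → C → List C) (φs : List (ι × (C → Fin M))) :
    φs.foldl (weightStep tab) none = none := by
  induction φs with
  | nil => rfl
  | cons i φs ih => simpa [weightStep] using ih

theorem applyAll_labelWord (tab : ι → C → List C) (φs : List (ι × (C → Fin M)))
    {n n' : C → Fin M} (h : φs.foldl (weightStep tab) (some n) = some n') (k : Fin M)
    (v : List C) :
    applyAll (labelTab tab) φs (labelWord n k v) =
      labelWord n' k (applyAll tab (φs.map Prod.fst) v) := by
  induction φs generalizing n v with
  | nil =>
    obtain rfl : n = n' := by simpa using h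
    rfl
  | cons i φs ih =>
    rw [List.foldl_cons] at h
    by_cases hn : n = pullWeight (tab i.1) i.2
    · subst hn
      rw [weightStep, if_pos rfl] at h
      simp only [applyAll_cons, List.map_cons]
      rw [subApply_labelWord, ih h]
    · rw [weightStep, if_neg (by simpa using hn), foldl_weightStep_none] at h
      simp at h

theorem exists_consistent_weights (tab : ι → C → List C) (φs : List ι) (n' : C → Fin M) :
    ∃ (n : C → Fin M) (ψs : List (ι × (C → Fin M))), ψs.map Prod.fst = φs ∧
      ψs.foldl (weightStep tab) (some n) = some n' := by
  induction φs with
  | nil => exact ⟨n', [], rfl, rfl⟩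
  | cons i φs ih =>
    obtain ⟨n, ψs, rfl, h⟩ := ih
    refine ⟨pullWeight (tab i) n, (i, n) :: ψs, rfl, ?_⟩
    rw [List.foldl_cons, weightStep, if_pos rfl, h]

theorem foldl_prod {α : Type*} {σ₁ σ₂ : Type*} (f : σ₁ → α → σ₁) (g : σ₂ → α → σ₂)
    (l : List α) (p : σ₁ × σ₂) :
    l.foldl (fun q a => (f q.1 a, g q.2 a)) p = (l.foldl f p.1, l.foldl g p.2) := by
  induction l generalizing p with
  | nil => rfl
  | cons a l ih => simp [ih]

variable {β : Type*}

open Classical in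
/-- The number of letters `#` (as an element of `Fin M`) given by a letter. -/
noncomputable def hashWeight (M : ℕ) [NeZero M] (term : C → Option (β ⊕ Unit)) (c : C) : Fin M :=
  if term c = some (Sum.inr ()) then 1 else 0

/-- Keep the terminal letters of label `0`, and erase the other terminal letters. -/
def labelOut (term : C → Option (β ⊕ Unit)) (c : C × Fin M) : List (Option β) :=
  match term c.1 with
  | none => [none]
  | some (Sum.inl a) => if c.2 = 0 then [some a] else []
  | some (Sum.inr _) => []

theorem flatMap_labelOut (term : C → Option (β ⊕ Unit)) {v : List C} {u : List (β ⊕ Unit)}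
    (h : v.map term = u.map some) (k : Fin M) :
    (labelWord (hashWeight M term) k v).flatMap (labelOut term) = (hashBlock k u).map some := by
  induction v generalizing k u with
  | nil =>
    obtain rfl : u = [] := by simpa using h.symm
    rfl
  | cons c v ih =>
    cases u with
    | nil => simp at h
    | cons x u =>
      obtain ⟨hc, hv⟩ : term c = some x ∧ v.map term = u.map some := by simpa using h
      cases x with
      | inl a =>
        simp only [labelWord, List.flatMap_cons, ih hv, labelOut, hashWeight, hc, hashBlock]
        split_ifs <;> simp_all
      | inr a => simp [labelWord, ih hv, labelOut, hashWeight, hc, hashBlock]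

end Segments

theorem isParallelEDT0L_of_isEDT0L {β : Type} {m : ℕ} {T : Set (Fin m → List β)}
    (h : IsEDT0L (hashWord '' T : Set (List (β ⊕ Unit)))) : IsParallelEDT0L T := by
  obtain ⟨S, hS⟩ := h
  rcases Nat.eq_zero_or_pos m with rfl | hm
  · refine ⟨Empty, Unit, Empty, Unit, inferInstance, inferInstance, inferInstance, inferInstance,
      fun i => i.elim, fun c => c.elim, fun _ _ => [], fun q _ => q, fun _ => (),
      {_q | T.Nonempty}, fun t => ⟨fun ht => ⟨(), [], ⟨t, ht⟩, fun b => b.elim0⟩, ?_⟩⟩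
    rintro ⟨-, -, ⟨s, hs⟩, -⟩
    rwa [Subsingleton.elim t s]
  have : NeZero m := ⟨hm.ne'⟩
  obtain ⟨σ, hσ, A, hA⟩ := S.control_reg
  have := S.finC
  have := S.finι
  have hmem : ∀ u, u ∈ hashWord '' T ↔
      ∃ φs ∈ S.control, (applyAll S.tab φs S.start).map S.term = u.map some := by
    intro u
    rw [← hS]
    rfl
  refine ⟨S.C × Fin m, S.C → Fin m, S.ι × (S.C → Fin m), Option (S.C → Fin m) × σ,
    inferInstance, inferInstance, inferInstance, inferInstance, labelTab S.tab, labelOut S.term,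
    fun n b => labelWord n b S.start,
    fun q i => (weightStep S.tab q.1 i, A.step q.2 i.1), fun n => (some n, A.start),
    {q | q.1 = some (hashWeight m S.term) ∧ q.2 ∈ A.accept}, fun t => ?_⟩
  have hfold : ∀ (n : S.C → Fin m) (ψs : List (S.ι × (S.C → Fin m))),
      ψs.foldl (fun (q : Option (S.C → Fin m) × σ) i =>
        (weightStep S.tab q.1 i, A.step q.2 i.1)) (some n, A.start) =
      (ψs.foldl (weightStep S.tab) (some n), A.eval (ψs.map Prod.fst)) := by
    intro n ψs
    rw [foldl_prod (weightStep S.tab) (fun q i => A.step q i.1)]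
    simp [DFA.eval, DFA.evalFrom, List.foldl_map]
  simp only [hfold, Set.mem_ofPred_eq]
  constructor
  · intro ht
    obtain ⟨φs, hφ, hterm⟩ := (hmem _).1 ⟨t, ht, rfl⟩
    obtain ⟨n, ψs, rfl, hn⟩ := exists_consistent_weights S.tab φs (hashWeight m S.term)
    refine ⟨n, ψs, ⟨hn, ?_⟩, fun b => ?_⟩
    · rw [← hA] at hφ
      exact hφ
    · rw [applyAll_labelWord S.tab ψs hn, flatMap_labelOut S.term hterm, hashBlock_hashWord]
  · rintro ⟨n, ψs, ⟨hn, hacc⟩, hout⟩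
    simp only [applyAll_labelWord S.tab ψs hn] at hout
    set v := applyAll S.tab (ψs.map Prod.fst) S.start with hv
    obtain ⟨u, hu⟩ : ∃ u : List (β ⊕ Unit), v.map S.term = u.map some := by
      refine exists_eq_map_some fun o ho hnone => ?_
      obtain ⟨c, hc, rfl⟩ := List.mem_map.1 ho
      obtain ⟨k, hk⟩ := exists_mem_labelWord (hashWeight m S.term) 0 hc
      have hmem' : none ∈ (labelWord (hashWeight m S.term) 0 v).flatMap (labelOut S.term) :=
        List.mem_flatMap.2 ⟨_, hk, by simp [labelOut, hnone]⟩
      rw [hout 0] at hmem'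
      simp at hmem'
    obtain ⟨s, hs, rfl⟩ := (hmem u).2 ⟨_, by rw [← hA]; exact hacc, hu⟩
    have : t = s := by
      funext b
      apply map_some_injective
      rw [← hout b, flatMap_labelOut S.term hu, hashBlock_hashWord]
    rwa [this]

section Shuffle

variable {C₁ C₂ ι₁ ι₂ : Type*}

/-- Two families of substitutions acting on the disjoint union of the alphabets. -/
def sumTab (tab₁ : ι₁ → C₁ → List C₁) (tab₂ : ι₂ → C₂ → List C₂) :
    ι₁ ⊕ ι₂ → C₁ ⊕ C₂ → List (C₁ ⊕ C₂)
  | Sum.inl i, Sum.inl c => (tab₁ i c).map Sum.inl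
  | Sum.inr i, Sum.inr c => (tab₂ i c).map Sum.inr
  | _, c => [c]

theorem applyAll_sumTab_inl (tab₁ : ι₁ → C₁ → List C₁) (tab₂ : ι₂ → C₂ → List C₂)
    (φs : List (ι₁ ⊕ ι₂)) (v : List C₁) :
    applyAll (sumTab tab₁ tab₂) φs (v.map Sum.inl) =
      (applyAll tab₁ (φs.filterMap Sum.getLeft?) v).map Sum.inl := by
  induction φs generalizing v with
  | nil => rfl
  | cons i φs ih =>
    cases i with
    | inl i =>
      rw [applyAll_cons, subApply_map (sumTab tab₁ tab₂ (Sum.inl i)) (tab₁ i) _ fun c => rfl, ih]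
      simp
    | inr i =>
      rw [applyAll_cons, subApply_map_eq_self _ _ fun c => rfl, ih]
      simp [List.filterMap_cons]

theorem applyAll_sumTab_inr (tab₁ : ι₁ → C₁ → List C₁) (tab₂ : ι₂ → C₂ → List C₂)
    (φs : List (ι₁ ⊕ ι₂)) (v : List C₂) :
    applyAll (sumTab tab₁ tab₂) φs (v.map Sum.inr) =
      (applyAll tab₂ (φs.filterMap Sum.getRight?) v).map Sum.inr := by
  induction φs generalizing v with
  | nil => rfl
  | cons i φs ih =>
    cases i with
    | inl i =>
      rw [applyAll_cons, subApply_map_eq_self _ _ fun c => rfl, ih]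
      simp [List.filterMap_cons]
    | inr i =>
      rw [applyAll_cons, subApply_map (sumTab tab₁ tab₂ (Sum.inr i)) (tab₂ i) _ fun c => rfl, ih]
      simp

/-- The product of two automata reading the two parts of a shuffled word. -/
def sumStep {Q₁ Q₂ : Type*} (step₁ : Q₁ → ι₁ → Q₁) (step₂ : Q₂ → ι₂ → Q₂) (q : Q₁ × Q₂) :
    ι₁ ⊕ ι₂ → Q₁ × Q₂
  | Sum.inl i => (step₁ q.1 i, q.2)
  | Sum.inr i => (q.1, step₂ q.2 i)

theorem foldl_sumStep {Q₁ Q₂ : Type*} (step₁ : Q₁ → ι₁ → Q₁) (step₂ : Q₂ → ι₂ → Q₂)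
    (q : Q₁ × Q₂) (φs : List (ι₁ ⊕ ι₂)) :
    φs.foldl (sumStep step₁ step₂) q =
      ((φs.filterMap Sum.getLeft?).foldl step₁ q.1,
        (φs.filterMap Sum.getRight?).foldl step₂ q.2) := by
  induction φs generalizing q with
  | nil => rfl
  | cons i φs ih => cases i <;> simp [ih, sumStep, List.filterMap_cons]

@[simp] theorem filterMap_getLeft_sum (u : List ι₁) (v : List ι₂) :
    (u.map Sum.inl ++ v.map Sum.inr).filterMap Sum.getLeft? = u := by
  simp [List.filterMap_append, List.filterMap_map, Function.comp_def]

@[simp] theorem filterMap_getRight_sum (u : List ι₁) (v : List ι₂) :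
    (u.map Sum.inl ++ v.map Sum.inr).filterMap Sum.getRight? = v := by
  simp [List.filterMap_append, List.filterMap_map, Function.comp_def]

end Shuffle

theorem IsParallelEDT0L.append {β₁ β₂ β : Type} {m : ℕ} {T₁ : Set (Fin m → List β₁)}
    {T₂ : Set (Fin m → List β₂)} (h₁ : IsParallelEDT0L T₁) (h₂ : IsParallelEDT0L T₂)
    (f : β₁ → β) (g : β₂ → β) :
    IsParallelEDT0L {t : Fin m → List β | ∃ t₁ ∈ T₁, ∃ t₂ ∈ T₂,
      t = fun b => (t₁ b).map f ++ (t₂ b).map g} := by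
  obtain ⟨C₁, J₁, ι₁, Q₁, _, _, _, _, tab₁, out₁, start₁, step₁, init₁, acc₁, h₁⟩ := h₁
  obtain ⟨C₂, J₂, ι₂, Q₂, _, _, _, _, tab₂, out₂, start₂, step₂, init₂, acc₂, h₂⟩ := h₂
  let out : C₁ ⊕ C₂ → List (Option β) :=
    Sum.elim (fun c => (out₁ c).map (Option.map f)) (fun c => (out₂ c).map (Option.map g))
  have hrun : ∀ (φs : List (ι₁ ⊕ ι₂)) (v₁ : List C₁) (v₂ : List C₂),
      (applyAll (sumTab tab₁ tab₂) φs (v₁.map Sum.inl ++ v₂.map Sum.inr)).flatMap out =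
        ((applyAll tab₁ (φs.filterMap Sum.getLeft?) v₁).flatMap out₁).map (Option.map f) ++
        ((applyAll tab₂ (φs.filterMap Sum.getRight?) v₂).flatMap out₂).map (Option.map g) := by
    intro φs v₁ v₂
    rw [applyAll_append, applyAll_sumTab_inl, applyAll_sumTab_inr]
    simp [out, List.flatMap_map, List.map_flatMap]
  refine ⟨C₁ ⊕ C₂, J₁ × J₂, ι₁ ⊕ ι₂, Q₁ × Q₂, inferInstance, inferInstance, inferInstance,
    inferInstance, sumTab tab₁ tab₂, out,
    fun j b => (start₁ j.1 b).map Sum.inl ++ (start₂ j.2 b).map Sum.inr,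
    sumStep step₁ step₂, fun j => (init₁ j.1, init₂ j.2), acc₁ ×ˢ acc₂, fun t => ?_⟩
  simp only [hrun, foldl_sumStep, Set.mem_prod]
  constructor
  · rintro ⟨t₁, ht₁, t₂, ht₂, rfl⟩
    obtain ⟨j₁, φ₁, hacc₁, hout₁⟩ := (h₁ t₁).1 ht₁
    obtain ⟨j₂, φ₂, hacc₂, hout₂⟩ := (h₂ t₂).1 ht₂
    refine ⟨(j₁, j₂), φ₁.map Sum.inl ++ φ₂.map Sum.inr, ?_, fun b => ?_⟩
    · rw [filterMap_getLeft_sum, filterMap_getRight_sum]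
      exact ⟨hacc₁, hacc₂⟩
    · rw [filterMap_getLeft_sum, filterMap_getRight_sum, hout₁, hout₂]
      simp
  · rintro ⟨j, φs, ⟨hacc₁, hacc₂⟩, hout⟩
    choose t₁ ht₁ using fun b => exists_eq_map_some_of_subset f
      (by rw [← hout b]; exact List.subset_append_left _ _)
    choose t₂ ht₂ using fun b => exists_eq_map_some_of_subset g
      (by rw [← hout b]; exact List.subset_append_right _ _)
    refine ⟨t₁, (h₁ t₁).2 ⟨_, _, hacc₁, ht₁⟩, t₂, (h₂ t₂).2 ⟨_, _, hacc₂, ht₂⟩, ?_⟩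
    funext b
    apply map_some_injective
    rw [← hout b, ht₁ b, ht₂ b]
    simp

section Assemble

variable {β C J ι Q : Type*} {m : ℕ}

/-- The tables of the system which first replaces the start symbol by the hash-separated start
words, then applies tables of the given system, and finally writes the output. -/
def joinTab (tab : ι → C → List C) (out : C → List (Option β)) (start : J → Fin m → List C) :
    J ⊕ Option ι → Option (C ⊕ Option (β ⊕ Unit)) → List (Option (C ⊕ Option (β ⊕ Unit)))
  | Sum.inl j, none => List.intercalate [some (Sum.inr (some (Sum.inr ())))]
      (List.ofFn fun b => (start j b).map fun c => some (Sum.inl c))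
  | Sum.inr (some i), some (Sum.inl c) => (tab i c).map fun c => some (Sum.inl c)
  | Sum.inr none, some (Sum.inl c) => (out c).map fun o => some (Sum.inr (o.map Sum.inl))
  | _, c => [c]

/-- The terminal letters of the assembled system. -/
def joinTerm : Option (C ⊕ Option (β ⊕ Unit)) → Option (β ⊕ Unit)
  | some (Sum.inr o) => o
  | _ => none

/-- The transitions of the control of the assembled system: `some (inr true)` is the initial
state, `some (inr false)` the final state, and `none` a sink. -/
def joinStep (step : Q → ι → Q) (init : J → Q) (acc : Set Q) [DecidablePred (· ∈ acc)] :
    Option (Q ⊕ Bool) → J ⊕ Option ι → Option (Q ⊕ Bool)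
  | some (Sum.inr true), Sum.inl j => some (Sum.inl (init j))
  | some (Sum.inl q), Sum.inr (some i) => some (Sum.inl (step q i))
  | some (Sum.inl q), Sum.inr none => if q ∈ acc then some (Sum.inr false) else none
  | _, _ => none

variable (step : Q → ι → Q) (init : J → Q) (acc : Set Q) [DecidablePred (· ∈ acc)]

theorem foldl_joinStep_none (w : List (J ⊕ Option ι)) :
    w.foldl (joinStep step init acc) none = none := by
  induction w with
  | nil => rfl
  | cons i w ih => simpa [joinStep] using ih

theorem foldl_joinStep_run (q : Q) (w : List (J ⊕ Option ι)) :
    w.foldl (joinStep step init acc) (some (Sum.inl q)) = some (Sum.inr false) ↔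
      ∃ φs : List ι, w = φs.map (fun i => Sum.inr (some i)) ++ [Sum.inr none] ∧
        φs.foldl step q ∈ acc := by
  induction w generalizing q with
  | nil => simp
  | cons x w ih =>
    rcases x with j | _ | i
    · simp only [List.foldl_cons, joinStep, foldl_joinStep_none]
      simp only [reduceCtorEq, false_iff, not_exists, not_and]
      rintro (_ | ⟨i, φs⟩) h <;> simp at h
    · simp only [List.foldl_cons, joinStep]
      constructor
      · intro h
        split_ifs at h with hq
        · cases w with
          | nil => exact ⟨[], rfl, hq⟩
          | cons y w =>
            rw [List.foldl_cons] at h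
            simp only [joinStep] at h
            rw [foldl_joinStep_none] at h
            simp at h
        · rw [foldl_joinStep_none] at h
          simp at h
      · rintro ⟨_ | ⟨i, φs⟩, h, hq⟩
        · obtain rfl : w = [] := by simpa using h
          rw [List.foldl_nil] at hq ⊢
          rw [if_pos hq]
        · simp at h
    · simp only [List.foldl_cons, joinStep, ih]
      constructor
      · rintro ⟨φs, rfl, hq⟩
        exact ⟨i :: φs, rfl, hq⟩
      · rintro ⟨_ | ⟨i', φs⟩, h, hq⟩
        · simp at h
        · obtain ⟨rfl, rfl⟩ : i = i' ∧ w = _ := by simpa using h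
          exact ⟨φs, rfl, hq⟩

theorem foldl_joinStep_start (w : List (J ⊕ Option ι)) :
    w.foldl (joinStep step init acc) (some (Sum.inr true)) = some (Sum.inr false) ↔
      ∃ (j : J) (φs : List ι),
        w = Sum.inl j :: (φs.map (fun i => Sum.inr (some i)) ++ [Sum.inr none]) ∧
        φs.foldl step (init j) ∈ acc := by
  cases w with
  | nil => simp
  | cons x w =>
    cases x with
    | inl j =>
      simp only [List.foldl_cons, joinStep, foldl_joinStep_run]
      constructor
      · rintro ⟨φs, rfl, h⟩
        exact ⟨j, φs, rfl, h⟩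
      · rintro ⟨j', φs, h, hacc⟩
        obtain ⟨rfl, rfl⟩ : j = j' ∧ w = _ := by simpa using h
        exact ⟨φs, rfl, hacc⟩
    | inr o => simp [joinStep, foldl_joinStep_none]

theorem applyAll_joinTab_run (tab : ι → C → List C) (out : C → List (Option β))
    (start : J → Fin m → List C) (x : Fin m → List C) (φs : List ι) :
    applyAll (joinTab tab out start) (φs.map fun i => Sum.inr (some i))
      (List.intercalate [some (Sum.inr (some (Sum.inr ())))]
        (List.ofFn fun b => (x b).map fun c => some (Sum.inl c))) =
      List.intercalate [some (Sum.inr (some (Sum.inr ())))]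
        (List.ofFn fun b => (applyAll tab φs (x b)).map fun c => some (Sum.inl c)) := by
  induction φs generalizing x with
  | nil => rfl
  | cons i φs ih =>
    simp only [List.map_cons, applyAll_cons]
    rw [subApply_intercalate, List.map_ofFn, ← ih]
    congr 2
    congr 1
    funext b
    exact subApply_map (joinTab tab out start (Sum.inr (some i))) (tab i) _ (fun c => rfl) _

theorem map_joinTerm_applyAll (tab : ι → C → List C) (out : C → List (Option β))
    (start : J → Fin m → List C) (j : J) (φs : List ι) :
    (applyAll (joinTab tab out start)
      (Sum.inl j :: (φs.map (fun i => Sum.inr (some i)) ++ [Sum.inr none])) [none]).map joinTerm =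
      List.intercalate [some (Sum.inr ())]
        (List.ofFn fun b =>
          ((applyAll tab φs (start j b)).flatMap out).map (Option.map Sum.inl)) := by
  have hstart : subApply (joinTab tab out start (Sum.inl j)) [none] =
      List.intercalate [some (Sum.inr (some (Sum.inr ())))]
        (List.ofFn fun b => (start j b).map fun c => some (Sum.inl c)) := by
    simp [joinTab]
  rw [applyAll_cons, hstart, applyAll_concat, applyAll_joinTab_run, subApply_intercalate,
    map_intercalate', List.map_ofFn, List.map_ofFn]
  congr 2
  funext b
  simp [subApply, joinTab, joinTerm, List.flatMap_def, Function.comp_def]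

end Assemble

theorem IsParallelEDT0L.isEDT0L {β : Type} [Finite β] {m : ℕ} {T : Set (Fin m → List β)}
    (h : IsParallelEDT0L T) : IsEDT0L (hashWord '' T : Set (List (β ⊕ Unit))) := by
  classical
  obtain ⟨C, J, ι, Q, _, _, _, _, tab, out, start, step, init, acc, h⟩ := h
  let A : DFA (J ⊕ Option ι) (Option (Q ⊕ Bool)) :=
    ⟨joinStep step init acc, some (Sum.inr true), {some (Sum.inr false)}⟩
  refine ⟨⟨Option (C ⊕ Option (β ⊕ Unit)), Fintype.ofFinite _, joinTerm, ?_, [none],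
    J ⊕ Option ι, Fintype.ofFinite _, joinTab tab out start, A.accepts,
    ⟨_, Fintype.ofFinite _, A, rfl⟩⟩, ?_⟩
  · rintro (_ | _ | _) (_ | _ | _) a h h' <;> simp_all [joinTerm]
  ext w
  have hacc : ∀ ψs, ψs ∈ A.accepts ↔ ∃ (j : J) (φs : List ι),
      ψs = Sum.inl j :: (φs.map (fun i => Sum.inr (some i)) ++ [Sum.inr none]) ∧
        φs.foldl step (init j) ∈ acc :=
    fun ψs => foldl_joinStep_start step init acc ψs
  change (∃ ψs ∈ A.accepts, (applyAll (joinTab tab out start) ψs [none]).map joinTerm =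
    w.map some) ↔ ∃ t ∈ T, hashWord t = w
  simp only [hacc]
  constructor
  · rintro ⟨-, ⟨j, φs, rfl, hφ⟩, hw⟩
    rw [map_joinTerm_applyAll] at hw
    choose t ht using fun b => exists_eq_map_some_of_subset (Sum.inl : β → β ⊕ Unit)
      (by
        rw [← hw]
        exact mem_hash_intercalate _ ((List.mem_ofFn' _ _).2 ⟨b, rfl⟩))
    refine ⟨t, (h t).2 ⟨j, φs, hφ, ht⟩, map_some_injective ?_⟩
    rw [← hw, map_some_hashWord]
    simp only [ht]
  · rintro ⟨t, ht, rfl⟩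
    obtain ⟨j, φs, hφ, hout⟩ := (h t).1 ht
    refine ⟨_, ⟨j, φs, rfl, hφ⟩, ?_⟩
    rw [map_joinTerm_applyAll, map_some_hashWord]
    simp only [hout]

theorem solvesSystem_image_map {G K : Type*} [Group G] [Group K] (f : G →* K) {m : ℕ}
    (E : Set (Monoid.Coprod G (FreeGroup (Fin m)))) (g : Fin m → G) :
    SolvesSystem (Monoid.Coprod.map f (MonoidHom.id (FreeGroup (Fin m))) '' E) (f ∘ g) ↔
      ∀ e ∈ E, f (Monoid.Coprod.lift (MonoidHom.id G) (FreeGroup.lift g) e) = 1 := by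
  have key : (Monoid.Coprod.lift (MonoidHom.id K) (FreeGroup.lift (f ∘ g))).comp
      (Monoid.Coprod.map f (MonoidHom.id _)) =
      f.comp (Monoid.Coprod.lift (MonoidHom.id G) (FreeGroup.lift g)) := by
    ext <;> simp
  simp only [SolvesSystem, Set.forall_mem_image]
  exact forall₂_congr fun e _ => by rw [← MonoidHom.comp_apply, key, MonoidHom.comp_apply]

theorem solvesSystem_prod {G H : Type*} [Group G] [Group H] {m : ℕ}
    (E : Set (Monoid.Coprod (G × H) (FreeGroup (Fin m)))) (g : Fin m → G × H) :
    SolvesSystem E g ↔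
      SolvesSystem (Monoid.Coprod.map (MonoidHom.fst G H) (MonoidHom.id _) '' E)
        (fun i => (g i).1) ∧
      SolvesSystem (Monoid.Coprod.map (MonoidHom.snd G H) (MonoidHom.id _) '' E)
        (fun i => (g i).2) := by
  have h₁ := solvesSystem_image_map (MonoidHom.fst G H) E g
  have h₂ := solvesSystem_image_map (MonoidHom.snd G H) E g
  simp only [Function.comp_def, MonoidHom.coe_fst, MonoidHom.coe_snd] at h₁ h₂
  rw [h₁, h₂, SolvesSystem, ← forall₂_and]
  simp only [Prod.ext_iff, Prod.fst_one, Prod.snd_one]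

theorem solutionLanguage_eq_image {G : Type*} [Group G] {ι : Type*} (η : G → List (ι × Bool))
    {m : ℕ} (E : Set (Monoid.Coprod G (FreeGroup (Fin m)))) :
    solutionLanguage η E =
      (hashWord '' {t | ∃ g, SolvesSystem E g ∧ t = fun i => η (g i)} : Set (List _)) := by
  ext w
  constructor
  · rintro ⟨g, hg, -, rfl⟩
    exact ⟨_, ⟨g, hg, rfl⟩, rfl⟩
  · rintro ⟨-, ⟨g, hg, rfl⟩, rfl⟩
    exact ⟨g, hg, fun _ => trivial, rfl⟩

section Regular

variable {α β : Type*} {Q₁ Q₂ : Type*}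

/-- The transitions of an automaton reading a word over `α` followed by a word over `β`; the
Boolean records whether a letter of `β` has been read, and `none` is a sink. -/
def blockStep (step₁ : Q₁ → α → Q₁) (step₂ : Q₂ → β → Q₂) :
    Option (Q₁ × Q₂ × Bool) → α ⊕ β → Option (Q₁ × Q₂ × Bool)
  | some (p, q, false), Sum.inl a => some (step₁ p a, q, false)
  | some (p, q, _), Sum.inr b => some (p, step₂ q b, true)
  | _, _ => none

variable (step₁ : Q₁ → α → Q₁) (step₂ : Q₂ → β → Q₂)

theorem foldl_blockStep_none (w : List (α ⊕ β)) :
    w.foldl (blockStep step₁ step₂) none = none := by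
  induction w with
  | nil => rfl
  | cons x w ih => simpa [blockStep] using ih

theorem foldl_blockStep_true (p p' : Q₁) (q q' : Q₂) (s : Bool) (w : List (α ⊕ β)) :
    w.foldl (blockStep step₁ step₂) (some (p, q, true)) = some (p', q', s) ↔
      ∃ v : List β, w = v.map Sum.inr ∧ p = p' ∧ v.foldl step₂ q = q' ∧ s = true := by
  induction w generalizing q with
  | nil =>
    constructor
    · rintro ⟨⟩
      exact ⟨[], rfl, rfl, rfl, rfl⟩
    · rintro ⟨v, hv, rfl, rfl, rfl⟩
      obtain rfl : v = [] := by simpa using hv.symm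
      rfl
  | cons x w ih =>
    cases x with
    | inl a =>
      simp only [List.foldl_cons, blockStep, foldl_blockStep_none]
      simp only [reduceCtorEq, false_iff, not_exists, not_and]
      rintro (_ | ⟨b, v⟩) h <;> simp at h
    | inr b =>
      simp only [List.foldl_cons, blockStep, ih]
      constructor
      · rintro ⟨v, rfl, h⟩
        exact ⟨b :: v, rfl, h⟩
      · rintro ⟨_ | ⟨b', v⟩, h, h'⟩
        · simp at h
        · obtain ⟨rfl, rfl⟩ : b = b' ∧ w = _ := by simpa using h
          exact ⟨v, rfl, h'⟩

theorem foldl_blockStep_false (p p' : Q₁) (q q' : Q₂) (w : List (α ⊕ β)) :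
    (∃ s, w.foldl (blockStep step₁ step₂) (some (p, q, false)) = some (p', q', s)) ↔
      ∃ (u : List α) (v : List β), w = u.map Sum.inl ++ v.map Sum.inr ∧
        u.foldl step₁ p = p' ∧ v.foldl step₂ q = q' := by
  induction w generalizing p with
  | nil =>
    constructor
    · rintro ⟨s, ⟨⟩⟩
      exact ⟨[], [], rfl, rfl, rfl⟩
    · rintro ⟨u, v, h, rfl, rfl⟩
      obtain ⟨rfl, rfl⟩ : u = [] ∧ v = [] := by simpa using h.symm
      exact ⟨false, rfl⟩
  | cons x w ih =>
    cases x with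
    | inl a =>
      simp only [List.foldl_cons, blockStep, ih]
      constructor
      · rintro ⟨u, v, rfl, h⟩
        exact ⟨a :: u, v, rfl, h⟩
      · rintro ⟨_ | ⟨a', u⟩, v, h, h'⟩
        · cases v <;> simp at h
        · obtain ⟨rfl, rfl⟩ : a = a' ∧ w = _ := by simpa using h
          exact ⟨u, v, rfl, h'⟩
    | inr b =>
      simp only [List.foldl_cons, blockStep, foldl_blockStep_true]
      constructor
      · rintro ⟨s, v, rfl, hp, hq, rfl⟩
        exact ⟨[], b :: v, rfl, hp, hq⟩
      · rintro ⟨_ | ⟨a', u⟩, _ | ⟨b', v⟩, h, hp, hq⟩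
        · simp at h
        · obtain ⟨rfl, rfl⟩ : b = b' ∧ w = _ := by simpa using h
          exact ⟨true, v, rfl, hp, hq, rfl⟩
        · simp at h
        · simp at h

end Regular

theorem isRegular_image2_append {α β γ : Type*} {L₁ : Language α} {L₂ : Language β}
    (h₁ : L₁.IsRegular) (h₂ : L₂.IsRegular) (e : γ ≃ α ⊕ β) :
    Language.IsRegular (Set.image2 (fun u v => u.map (fun a => e.symm (Sum.inl a)) ++
      v.map fun b => e.symm (Sum.inr b)) L₁ L₂ : Language γ) := by
  obtain ⟨Q₁, _, A₁, rfl⟩ := h₁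
  obtain ⟨Q₂, _, A₂, rfl⟩ := h₂
  refine ⟨Option (Q₁ × Q₂ × Bool), inferInstance,
    ⟨fun q c => blockStep A₁.step A₂.step q (e c), some (A₁.start, A₂.start, false),
      {q | ∃ p' ∈ A₁.accept, ∃ q' ∈ A₂.accept, ∃ s, q = some (p', q', s)}⟩, ?_⟩
  ext w
  rw [DFA.mem_accepts, DFA.eval, DFA.evalFrom, ← List.foldl_map (f := e)]
  simp only [Set.mem_ofPred_eq, foldl_blockStep_false]
  constructor
  · rintro ⟨-, hp, -, hq, u, v, h, rfl, rfl⟩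
    refine ⟨u, hp, v, hq, ?_⟩
    apply List.map_injective_iff.2 e.injective
    simp [h, Function.comp_def]
  · rintro ⟨u, hu, v, hv, rfl⟩
    exact ⟨_, hu, _, hv, u, v, by simp [Function.comp_def], rfl, rfl⟩

theorem isRegularNF_prod {G H ιG ιH : Type*} [Group G] [Group H] {ηG : G → List (ιG × Bool)}
    {ηH : H → List (ιH × Bool)} (hG : IsRegularNF ηG) (hH : IsRegularNF ηH) :
    IsRegularNF fun p : G × H => ((ηG p.1).map fun l => ((Sum.inl l.1 : ιG ⊕ ιH), l.2)) ++
      ((ηH p.2).map fun l => (Sum.inr l.1, l.2)) := by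
  have h := isRegular_image2_append hG hH (Equiv.sumProdDistrib ιG ιH Bool)
  refine (congrArg Language.IsRegular (Set.ext fun w => ⟨?_, ?_⟩)).mpr h
  · rintro ⟨p, rfl⟩
    exact ⟨_, ⟨p.1, rfl⟩, _, ⟨p.2, rfl⟩, rfl⟩
  · rintro ⟨-, ⟨g, rfl⟩, -, ⟨h, rfl⟩, rfl⟩
    exact ⟨(g, h), rfl⟩

section Length

variable {G H K ι κ : Type*} [Group G] [Group H] [Group K]

theorem wordLength_le (gen : ι → G) (w : List (ι × Bool)) :
    wordLength gen (evalWord gen w) ≤ w.length :=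
  Nat.sInf_le ⟨w, rfl, rfl⟩

theorem exists_length_eq_wordLength (gen : ι → G) {g : G}
    (h : ∃ w : List (ι × Bool), evalWord gen w = g) :
    ∃ w, evalWord gen w = g ∧ w.length = wordLength gen g :=
  Nat.sInf_mem (s := {n | ∃ w : List (ι × Bool), evalWord gen w = g ∧ w.length = n})
    (h.imp' List.length fun w hw => ⟨w, hw, rfl⟩)

theorem evalWord_cons (gen : ι → G) (l : ι × Bool) (w : List (ι × Bool)) :
    evalWord gen (l :: w) = (if l.2 then gen l.1 else (gen l.1)⁻¹) * evalWord gen w := by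
  simp [evalWord]

theorem evalWord_append (gen : ι → G) (u v : List (ι × Bool)) :
    evalWord gen (u ++ v) = evalWord gen u * evalWord gen v := by
  simp [evalWord]

theorem evalWord_map (f : G →* K) (gen : κ → K) (gen' : ι → G) (e : ι → κ)
    (h : ∀ i, gen (e i) = f (gen' i)) (w : List (ι × Bool)) :
    evalWord gen (w.map fun l => (e l.1, l.2)) = f (evalWord gen' w) := by
  simp only [evalWord, map_list_prod, List.map_map]
  congr 2
  funext l
  simp [h, apply_ite f]

/-- A homomorphism sending each generator to a generator or to `1` does not increase the word
length. -/
theorem wordLength_map_le (f : G →* K) (gen : ι → G) (gen' : κ → K) (e : ι → Option κ)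
    (h : ∀ i, f (gen i) = (e i).elim 1 gen') {g : G}
    (hg : ∃ w : List (ι × Bool), evalWord gen w = g) :
    wordLength gen' (f g) ≤ wordLength gen g := by
  obtain ⟨w, rfl, hw⟩ := exists_length_eq_wordLength gen hg
  rw [← hw]
  have key : f (evalWord gen w) =
      evalWord gen' (w.filterMap fun l => (e l.1).map fun i => (i, l.2)) := by
    clear hg hw
    induction w with
    | nil => simp [evalWord]
    | cons l w ih =>
      rw [evalWord_cons, map_mul, ih, apply_ite f, map_inv, h]
      cases hl : e l.1 <;> simp [hl, evalWord_cons]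
  rw [key]
  exact (wordLength_le _ _).trans (List.length_filterMap_le _ _)

theorem evalWord_prod (genG : ι → G) (genH : κ → H) (u : List (ι × Bool))
    (v : List (κ × Bool)) :
    evalWord (Sum.elim (fun i => ((genG i, 1) : G × H)) fun j => (1, genH j))
      (u.map (fun l => (Sum.inl l.1, l.2)) ++ v.map fun l => (Sum.inr l.1, l.2)) =
      (evalWord genG u, evalWord genH v) := by
  rw [evalWord_append, evalWord_map (MonoidHom.inl G H) _ genG Sum.inl fun i => rfl,
    evalWord_map (MonoidHom.inr G H) _ genH Sum.inr fun i => rfl]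
  simp

theorem isQuasigeodesicNF_prod {genG : ι → G} {genH : κ → H} {ηG : G → List (ι × Bool)}
    {ηH : H → List (κ × Bool)} (hηG : ∀ g, evalWord genG (ηG g) = g)
    (hηH : ∀ h, evalWord genH (ηH h) = h) (hG : IsQuasigeodesicNF genG ηG)
    (hH : IsQuasigeodesicNF genH ηH) :
    IsQuasigeodesicNF (Sum.elim (fun i => ((genG i, 1) : G × H)) fun j => (1, genH j))
      fun p => (ηG p.1).map (fun l => (Sum.inl l.1, l.2)) ++
        (ηH p.2).map fun l => (Sum.inr l.1, l.2) := by
  obtain ⟨a, ha, hG⟩ := hG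
  obtain ⟨b, hb, hH⟩ := hH
  refine ⟨a + b, add_pos ha hb, fun p => ?_⟩
  set gen : ι ⊕ κ → G × H := Sum.elim (fun i => (genG i, 1)) fun j => (1, genH j)
  have hp : ∃ w, evalWord gen w = p := ⟨_, by rw [evalWord_prod, hηG, hηH]⟩
  have h₁ : (wordLength genG p.1 : ℝ) ≤ wordLength gen p := by
    exact_mod_cast wordLength_map_le (MonoidHom.fst G H) gen genG Sum.getLeft?
      (by rintro (i | j) <;> rfl) hp
  have h₂ : (wordLength genH p.2 : ℝ) ≤ wordLength gen p := by
    exact_mod_cast wordLength_map_le (MonoidHom.snd G H) gen genH Sum.getRight?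
      (by rintro (i | j) <;> rfl) hp
  have h₃ := hG p.1
  have h₄ := hH p.2
  simp only [List.length_append, List.length_map]
  push_cast
  nlinarith [mul_le_mul_of_nonneg_left h₁ ha.le, mul_le_mul_of_nonneg_left h₂ hb.le]

end Length

/-- If all finite systems of equations in `G` (w.r.t. `η_G`) and in `H`
(w.r.t. `η_H`) have EDT0L solution languages, then so do all finite systems of equations
in `G × H` w.r.t. the normal form `η(g,h) = η_G(g)η_H(h)` over `Σ_G ⊔ Σ_H`; moreover if
`η_G, η_H` are both regular then so is `η`, and if both are quasigeodesic then so is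
`η`. -/
theorem edt0l_direct_product {G H : Type} [Group G] [Group H]
    {ιG ιH : Type} [Fintype ιG] [Fintype ιH]
    (genG : ιG → G) (genH : ιH → H)
    (hgenG : Subgroup.closure (Set.range genG) = ⊤)
    (hgenH : Subgroup.closure (Set.range genH) = ⊤)
    (ηG : G → List (ιG × Bool)) (ηH : H → List (ιH × Bool))
    (hηG : ∀ g, evalWord genG (ηG g) = g) (hηH : ∀ h, evalWord genH (ηH h) = h)
    (hGsys : ∀ (m : ℕ) (E : Set (Monoid.Coprod G (FreeGroup (Fin m)))), E.Finite →
      IsEDT0L (solutionLanguage ηG E))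
    (hHsys : ∀ (m : ℕ) (E : Set (Monoid.Coprod H (FreeGroup (Fin m)))), E.Finite →
      IsEDT0L (solutionLanguage ηH E))
    (η : G × H → List ((ιG ⊕ ιH) × Bool))
    (hη : ∀ p : G × H, η p =
      ((ηG p.1).map fun l => (Sum.inl l.1, l.2)) ++
      ((ηH p.2).map fun l => (Sum.inr l.1, l.2))) :
    (∀ (m : ℕ) (E : Set (Monoid.Coprod (G × H) (FreeGroup (Fin m)))), E.Finite →
      IsEDT0L (solutionLanguage η E)) ∧
    (IsRegularNF ηG ∧ IsRegularNF ηH → IsRegularNF η) ∧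
    (IsQuasigeodesicNF genG ηG ∧ IsQuasigeodesicNF genH ηH →
      IsQuasigeodesicNF
        (Sum.elim (fun i : ιG => ((genG i, (1 : H)) : G × H))
          (fun j : ιH => (((1 : G), genH j) : G × H))) η) := by
  obtain rfl : η = fun p => ((ηG p.1).map fun l => (Sum.inl l.1, l.2)) ++
      ((ηH p.2).map fun l => (Sum.inr l.1, l.2)) := funext hη
  refine ⟨fun m E hE => ?_, fun h => isRegularNF_prod h.1 h.2,
    fun h => isQuasigeodesicNF_prod hηG hηH h.1 h.2⟩
  have hG := hGsys m _ (hE.image (Monoid.Coprod.map (MonoidHom.fst G H) (MonoidHom.id _)))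
  have hH := hHsys m _ (hE.image (Monoid.Coprod.map (MonoidHom.snd G H) (MonoidHom.id _)))
  rw [solutionLanguage_eq_image] at hG hH ⊢
  have key := ((isParallelEDT0L_of_isEDT0L hG).append (isParallelEDT0L_of_isEDT0L hH)
    (fun l => ((Sum.inl l.1 : ιG ⊕ ιH), l.2)) fun l => (Sum.inr l.1, l.2)).isEDT0L
  refine (congrArg (fun T => IsEDT0L (hashWord '' T)) (Set.ext fun t => ⟨?_, ?_⟩)).mpr key
  · rintro ⟨g, hg, rfl⟩
    obtain ⟨h₁, h₂⟩ := (solvesSystem_prod E g).1 hg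
    exact ⟨_, ⟨_, h₁, rfl⟩, _, ⟨_, h₂, rfl⟩, rfl⟩
  · rintro ⟨-, ⟨g, hg, rfl⟩, -, ⟨h, hh, rfl⟩, rfl⟩
    exact ⟨fun i => (g i, h i), (solvesSystem_prod E _).2 ⟨hg, hh⟩, rfl⟩

end Paper
end

section
/- Let G be a finitely generated group with finite generating set Σ and normal form η such that the solution language of every finite system of equations in G with respect to η is EDT0L, and let H be a finite index subgroup of G. Then for every finite system E of equations in G with variables X₁, …, Xₙ, the language {η(g₁)#η(g₂)#⋯#η(gₙ) : Xᵢ ↦ gᵢ is a solution of E with gᵢ ∈ H for every i} is EDT0L. -/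
namespace Paper

theorem foldl_subApply {C Q : Type*} (t : C → List C) (f : C → Q → Q) (v : List C) (q : Q) :
    (subApply t v).foldl (fun q c => f c q) q =
      v.foldl (fun q c => (t c).foldl (fun q c => f c q) q) q := by
  induction v generalizing q with
  | nil => rfl
  | cons c v ih =>
    have h : subApply t (c :: v) = t c ++ subApply t v := by simp [subApply]
    rw [h, List.foldl_append, ih, List.foldl_cons]

/-- The transition of the letters of `C` under a DFA over the terminal alphabet; letters that are
not terminal act trivially. -/
def EDT0LSystem.letterStep {α Q : Type*} (S : EDT0LSystem α) (D : DFA α Q) (c : S.C) (q : Q) : Q :=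
  (S.term c).elim q (D.step q)

/-- The automaton reading a word of endomorphisms from right to left and computing the transition
that the image of each letter of `C` induces on the states of `D`. -/
def EDT0LSystem.transitionDFA {α Q : Type*} (S : EDT0LSystem α) (D : DFA α Q) :
    DFA S.ι (S.C → Q → Q) where
  step f i := fun c q => (S.tab i c).foldl (fun q c => f c q) q
  start := S.letterStep D
  accept := { f | S.start.foldl (fun q c => f c q) D.start ∈ D.accept }

theorem EDT0LSystem.foldl_apply {α Q : Type*} (S : EDT0LSystem α) (D : DFA α Q)
    (φs : List S.ι) (v : List S.C) (q : Q) :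
    (S.apply φs v).foldl (fun q c => S.letterStep D c q) q =
      v.foldl (fun q c => (S.transitionDFA D).eval φs.reverse c q) q := by
  induction φs generalizing v with
  | nil => rfl
  | cons i φs ih =>
    have h : S.apply (i :: φs) v = S.apply φs (subApply (S.tab i) v) := rfl
    rw [h, ih, foldl_subApply, List.reverse_cons, DFA.eval_append_singleton]
    rfl

theorem EDT0LSystem.foldl_letterStep {α Q : Type*} (S : EDT0LSystem α) (D : DFA α Q)
    (v : List S.C) (w : List α) (h : v.map S.term = w.map Option.some) (q : Q) :
    v.foldl (fun q c => S.letterStep D c q) q = D.evalFrom q w := by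
  induction v generalizing w q with
  | nil =>
    cases w with
    | nil => rfl
    | cons a w => simp at h
  | cons c v ih =>
    cases w with
    | nil => simp at h
    | cons a w =>
      simp only [List.map_cons, List.cons.injEq] at h
      rw [List.foldl_cons, ih w h.2, DFA.evalFrom_cons, EDT0LSystem.letterStep, h.1]
      rfl

/-- The intersection of an EDT0L language with a regular language is EDT0L. -/
theorem IsEDT0L.inf_isRegular {α : Type*} {L K : Language α} (hL : IsEDT0L L)
    (hK : K.IsRegular) : IsEDT0L (L ⊓ K) := by
  classical
  obtain ⟨S, rfl⟩ := hL
  obtain ⟨Q, _, D, rfl⟩ := hK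
  have := S.finC
  have hreg : (S.transitionDFA D).accepts.IsRegular := ⟨_, inferInstance, S.transitionDFA D, rfl⟩
  refine ⟨{ S with
    control := S.control ⊓ (S.transitionDFA D).accepts.reverse
    control_reg := S.control_reg.inf hreg.reverse }, ?_⟩
  have key : ∀ (φs : List S.ι) (w : List α),
      (S.apply φs S.start).map S.term = w.map Option.some →
      (φs ∈ (S.transitionDFA D).accepts.reverse ↔ w ∈ D.accepts) := by
    intro φs w h
    rw [Language.mem_reverse, DFA.mem_accepts, DFA.mem_accepts]
    change S.start.foldl _ _ ∈ D.accept ↔ _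
    rw [← S.foldl_apply, S.foldl_letterStep D _ w h]
    rfl
  ext w
  constructor
  · rintro ⟨φs, ⟨h₁, h₂⟩, h⟩
    exact ⟨⟨φs, h₁, h⟩, (key φs w h).1 h₂⟩
  · rintro ⟨⟨φs, h₁, h⟩, h₂⟩
    exact ⟨φs, ⟨h₁, (key φs w h).2 h₂⟩, h⟩

open Classical in
/-- The automaton tracking the coset of `H` of the inverse of the current block, and rejecting as
soon as a block ends outside `H`. -/
noncomputable def cosetDFA {G ι : Type*} [Group G] (gen : ι → G) (H : Subgroup G) :
    DFA ((ι × Bool) ⊕ Unit) (Option (G ⧸ H)) where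
  step s := Sum.elim
    (fun l => s.map fun x => (evalWord gen [l])⁻¹ • x)
    (fun _ => if s = some ((1 : G) : G ⧸ H) then s else none)
  start := some ((1 : G) : G ⧸ H)
  accept := {some ((1 : G) : G ⧸ H)}

theorem cosetDFA_evalFrom_none {G ι : Type*} [Group G] (gen : ι → G) (H : Subgroup G)
    (w : List ((ι × Bool) ⊕ Unit)) : (cosetDFA gen H).evalFrom none w = none := by
  induction w with
  | nil => rfl
  | cons a w ih =>
    have h : (cosetDFA gen H).step none a = none := by
      cases a <;> simp [cosetDFA]
    rw [DFA.evalFrom_cons, h, ih]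

theorem cosetDFA_evalFrom_map_inl {G ι : Type*} [Group G] (gen : ι → G) (H : Subgroup G)
    (w : List (ι × Bool)) (x : G ⧸ H) :
    (cosetDFA gen H).evalFrom (some x) (w.map Sum.inl) = some ((evalWord gen w)⁻¹ • x) := by
  induction w generalizing x with
  | nil => simp [evalWord]
  | cons l w ih =>
    have h : (cosetDFA gen H).step (some x) (Sum.inl l) = some ((evalWord gen [l])⁻¹ • x) := rfl
    have hl : evalWord gen (l :: w) = evalWord gen [l] * evalWord gen w := by simp [evalWord]
    rw [List.map_cons, DFA.evalFrom_cons, h, ih, hl, mul_inv_rev, mul_smul]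

theorem inv_smul_coe_one_eq_iff {G : Type*} [Group G] (H : Subgroup G) (g : G) :
    g⁻¹ • ((1 : G) : G ⧸ H) = ((1 : G) : G ⧸ H) ↔ g ∈ H := by
  rw [MulAction.Quotient.smul_coe, QuotientGroup.eq]
  simp

theorem cosetDFA_mem_accepts_intercalate {G ι : Type*} [Group G] (gen : ι → G) (H : Subgroup G)
    (ws : List (List (ι × Bool))) :
    List.intercalate [Sum.inr ()] (ws.map (List.map Sum.inl)) ∈ (cosetDFA gen H).accepts ↔
      ∀ w ∈ ws, evalWord gen w ∈ H := by
  rw [DFA.mem_accepts]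
  change (cosetDFA gen H).evalFrom (some ((1 : G) : G ⧸ H)) _ = some ((1 : G) : G ⧸ H) ↔ _
  induction ws with
  | nil => simp [List.intercalate]
  | cons w ws ih =>
    cases ws with
    | nil =>
      have h : List.intercalate [Sum.inr ()] ([w].map (List.map Sum.inl)) =
          w.map (Sum.inl : _ → (ι × Bool) ⊕ Unit) := by
        simp [List.intercalate]
      rw [h, cosetDFA_evalFrom_map_inl, Option.some_inj, inv_smul_coe_one_eq_iff,
        List.forall_mem_singleton]
    | cons w' ws =>
      have h : List.intercalate [Sum.inr ()] ((w :: w' :: ws).map (List.map Sum.inl)) =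
          w.map Sum.inl ++ (Sum.inr () ::
            List.intercalate [Sum.inr ()] ((w' :: ws).map (List.map Sum.inl))) := by
        simp [List.intercalate]
      rw [h, DFA.evalFrom_of_append, cosetDFA_evalFrom_map_inl, DFA.evalFrom_cons,
        List.forall_mem_cons]
      by_cases hw : evalWord gen w ∈ H
      · have hstep : (cosetDFA gen H).step
            (some ((evalWord gen w)⁻¹ • ((1 : G) : G ⧸ H))) (Sum.inr ()) =
              some ((1 : G) : G ⧸ H) := by
          rw [(inv_smul_coe_one_eq_iff H _).2 hw]
          simp [cosetDFA]
        rw [hstep, ih]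
        exact (and_iff_right hw).symm
      · have hstep : (cosetDFA gen H).step
            (some ((evalWord gen w)⁻¹ • ((1 : G) : G ⧸ H))) (Sum.inr ()) = none :=
          if_neg fun h => hw ((inv_smul_coe_one_eq_iff H _).1 (Option.some.inj h))
        rw [hstep, cosetDFA_evalFrom_none]
        simp [hw]

theorem hashWord_mem_cosetDFA_accepts {G ι : Type*} [Group G] (gen : ι → G) (H : Subgroup G)
    {m : ℕ} (ws : Fin m → List (ι × Bool)) :
    hashWord ws ∈ (cosetDFA gen H).accepts ↔ ∀ i, evalWord gen (ws i) ∈ H := by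
  have h : hashWord ws =
      List.intercalate [Sum.inr ()] ((List.ofFn ws).map (List.map Sum.inl)) := by
    rw [List.map_ofFn]
    rfl
  rw [h, cosetDFA_mem_accepts_intercalate, List.forall_mem_ofFn_iff]

/-- If every finite system of equations in `G` has an EDT0L solution
language w.r.t. `η`, and `H` is a finite index subgroup of `G`, then for every finite
system `E` of equations in `G`, the language of those solution tuples all of whose
entries lie in `H` (written in the normal form `η`) is EDT0L. -/
theorem edt0l_solutions_in_subgroup {G : Type} [Group G]
    {ι : Type} [Fintype ι] (gen : ι → G)
    (hgen : Subgroup.closure (Set.range gen) = ⊤)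
    (η : G → List (ι × Bool)) (hη : ∀ g, evalWord gen (η g) = g)
    (hGsys : ∀ (m : ℕ) (E : Set (Monoid.Coprod G (FreeGroup (Fin m)))), E.Finite →
      IsEDT0L (solutionLanguage η E))
    (H : Subgroup G) [H.FiniteIndex]
    (m : ℕ) (E : Set (Monoid.Coprod G (FreeGroup (Fin m)))) (hE : E.Finite) :
    IsEDT0L ({ w | ∃ g : Fin m → G, SolvesSystem E g ∧ (∀ i, g i ∈ H) ∧
        w = hashWord fun i => η (g i) } : Language ((ι × Bool) ⊕ Unit)) := by
  have hK : (cosetDFA gen H).accepts.IsRegular :=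
    ⟨_, Fintype.ofFinite _, cosetDFA gen H, rfl⟩
  refine (congrArg IsEDT0L (Set.ext fun w => ?_)).mpr ((hGsys m E hE).inf_isRegular hK)
  constructor
  · rintro ⟨g, hg, hgH, rfl⟩
    refine ⟨⟨g, hg, fun _ => Set.mem_univ _, rfl⟩, ?_⟩
    exact (hashWord_mem_cosetDFA_accepts gen H _).2 fun i => by simpa only [hη] using hgH i
  · rintro ⟨⟨g, hg, -, rfl⟩, hw⟩
    refine ⟨g, hg, fun i => ?_, rfl⟩
    simpa only [hη] using (hashWord_mem_cosetDFA_accepts gen H _).1 hw i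

end Paper
end
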